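/- Let t be a quasi-tree of a grammar G and let t₁ be a subtree of t. Then α(t₁) ≼ α(t), and hence rank(α(t₁)) ≤ rank(α(t)). -/

import Mathlib

/-- The two-letter Dyck alphabet: `D.ab` is `ā` (the opening symbol) and `D.a` is `a`
(the closing symbol). -/
inductive D where
  | ab : D  -- ā
  | a : D   -- a
deriving DecidableEq

/-- Parse trees of the grammar `G_D = ({S}, {ā, a}, S, {S → ā S a S, S → ε})`:
`eps` is an application of `S → ε` and `node t₁ t₂` an application of `S → ā S a S`. -/
inductive DyckTree where
  | eps : DyckTree
  | node : DyckTree → DyckTree → DyckTree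

/-- The word generated by a parse tree of `G_D`. -/
def DyckTree.yield : DyckTree → List D
  | .eps => []
  | .node t₁ t₂ => D.ab :: (t₁.yield ++ D.a :: t₂.yield)

/-- The Dyck language `L_D`: the language generated by `G_D`. -/
def LD : Set (List D) := { w | ∃ t : DyckTree, t.yield = w }

/-- `Matches t i j` holds iff positions `i < j` (0-indexed) of the word `t.yield` form a
matching pair: position `i` carries `ā`, position `j` carries `a`, and the two
corresponding leaves have the same parent in the parse tree `t`. -/
inductive Matches : DyckTree → ℕ → ℕ → Prop
  | head (t₁ t₂ : DyckTree) : Matches (.node t₁ t₂) 0 (t₁.yield.length + 1)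
  | left {t₁ : DyckTree} {i j : ℕ} (t₂ : DyckTree) :
      Matches t₁ i j → Matches (.node t₁ t₂) (i + 1) (j + 1)
  | right {t₂ : DyckTree} {i j : ℕ} (t₁ : DyckTree) :
      Matches t₂ i j → Matches (.node t₁ t₂) (t₁.yield.length + 2 + i) (t₁.yield.length + 2 + j)

/-- `DelStep w v`: `v` results from `w ∈ L_D` by deleting (both positions of) one
matching pair of `w`. -/
def DelStep (w v : List D) : Prop :=
  ∃ (t : DyckTree) (i j : ℕ), t.yield = w ∧ Matches t i j ∧
    v = (w.eraseIdx j).eraseIdx i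

/-- The ordering `≼` on Dyck words: `dyckLE v w` (i.e. `v ≼ w`) holds iff `v` results
from `w` by deleting 0 or more matching pairs. -/
def dyckLE (v w : List D) : Prop := Relation.ReflTransGen DelStep w v

/-- The harmonics: `h_0 = ε` and `h_{i+1} = ā h_i a ā h_i a`. -/
def harmonicW : ℕ → List D
  | 0 => []
  | i + 1 => (D.ab :: (harmonicW i ++ [D.a])) ++ (D.ab :: (harmonicW i ++ [D.a]))

/-- `ĥ_i = ā h_i a`. -/
def hatHarmonic (i : ℕ) : List D := D.ab :: (harmonicW i ++ [D.a])

/-- The rank of a Dyck word `w`: the greatest `q` such that `h_q ≼ w`. -/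
noncomputable def rank (w : List D) : ℕ := sSup { q : ℕ | dyckLE (harmonicW q) w }

/-- Finitely-branching labelled ordered trees (used to represent quasi-trees). -/
inductive RTree (L : Type) where
  | node : L → List (RTree L) → RTree L

/-- The label of the root of a tree. -/
def RTree.label {L : Type} : RTree L → L
  | .node l _ => l

/-- The list of children of the root of a tree. -/
def RTree.children {L : Type} : RTree L → List (RTree L)
  | .node _ ts => ts

/-- The footprint `α(n)` of a node `n` (identified with the subtree rooted at `n`):
`α(n) = a` if `n` is a leaf and `α(n) = a ā^k α(n₁) … α(n_k)` if `n` has the `k ≥ 1`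
children `n₁, …, n_k` (in that order). -/
def alphaN {L : Type} : RTree L → List D
  | .node _ ts =>
      D.a :: (List.replicate ts.length D.ab ++ (ts.attach.map (fun t => alphaN t.1)).flatten)
decreasing_by
  simp only [RTree.node.sizeOf_spec]
  have := List.sizeOf_lt_of_mem t.2
  omega

/-- The footprint `α(t)` of a tree `t` with root `n`: `α(t) = ā α(n)`. -/
def alphaT {L : Type} (t : RTree L) : List D := D.ab :: alphaN t

/-- `IsSubtree s t`: `s` is the subtree of `t` rooted at some node of `t`. -/
inductive IsSubtree {L : Type} : RTree L → RTree L → Prop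
  | refl (t : RTree L) : IsSubtree t t
  | child {s c : RTree L} (t : RTree L) : c ∈ t.children → IsSubtree s c → IsSubtree s t

/-- Labels of quasi-trees of a grammar with variables `N` and terminals `T`:
`none` stands for `ε`, `some (.inl X)` for a variable `X`, `some (.inr b)` for a
terminal `b`. -/
abbrev QLbl (N T : Type) := Option (N ⊕ T)

/-- `IsQuasiTree R t`: `t` is a quasi-tree of the grammar whose rules are `R`
(a rule `(X, w) ∈ R` stands for `X → w`): the root is labelled by some
`Z ∈ V ∪ Σ ∪ {ε}`, interior nodes are labelled by variables, leaves by terminals or by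
`ε` (an `ε`-leaf being the only child of its parent), and an interior node labelled `X`
with children labelled `X₁, …, X_k` (in order) corresponds to a rule `X → X₁ … X_k`
(a rule `X → ε` corresponding to an interior node `X` whose only child is an `ε`-leaf). -/
inductive IsQuasiTree {N T : Type} (R : Set (N × List (N ⊕ T))) :
    RTree (QLbl N T) → Prop
  | leafT (b : T) : IsQuasiTree R (.node (some (.inr b)) [])
  | leafE : IsQuasiTree R (.node none [])
  | nodeE {X : N} (h : (X, ([] : List (N ⊕ T))) ∈ R) :
      IsQuasiTree R (.node (some (.inl X)) [.node none []])
  | nodeR {X : N} {ts : List (RTree (QLbl N T))} {w : List (N ⊕ T)}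
      (hne : ts ≠ []) (hrule : (X, w) ∈ R) (hlab : ts.map RTree.label = w.map some)
      (hch : ∀ t ∈ ts, IsQuasiTree R t) :
      IsQuasiTree R (.node (some (.inl X)) ts)

/-!
STATEMENT 4: Let `t` be a quasi-tree of a grammar `G` and let `t₁` be a subtree of `t`.
Then `α(t₁) ≼ α(t)`, and hence `rank(α(t₁)) ≤ rank(α(t))`.
-/

theorem Matches.lt {t : DyckTree} {i j : ℕ} (h : Matches t i j) :
    i < j ∧ j < t.yield.length := by
  induction h with
  | head t₁ t₂ => simp [DyckTree.yield]
  | left t₂ _ ih => simp only [DyckTree.yield, List.length_cons, List.length_append]; omega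
  | right t₁ _ ih => simp only [DyckTree.yield, List.length_cons, List.length_append]; omega

theorem DelStep.length_le {w v : List D} (h : DelStep w v) : v.length ≤ w.length := by
  obtain ⟨_, i, j, -, -, rfl⟩ := h
  exact (List.length_eraseIdx_le _ _).trans (List.length_eraseIdx_le _ _)

theorem dyckLE.length_le {v w : List D} (h : dyckLE v w) : v.length ≤ w.length := by
  induction h with
  | refl => exact le_rfl
  | tail _ hs ih => exact hs.length_le.trans ih

theorem dyckLE.trans {u v w : List D} (huv : dyckLE u v) (hvw : dyckLE v w) : dyckLE u w :=
  Relation.ReflTransGen.trans hvw huv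

theorem nil_mem_LD : ([] : List D) ∈ LD := ⟨.eps, rfl⟩

theorem cons_append_cons_mem_LD {u v : List D} (hu : u ∈ LD) (hv : v ∈ LD) :
    D.ab :: (u ++ D.a :: v) ∈ LD := by
  obtain ⟨s, rfl⟩ := hu
  obtain ⟨t, rfl⟩ := hv
  exact ⟨.node s t, rfl⟩

theorem DelStep.left {w v z : List D} (h : DelStep w v) (hz : z ∈ LD) :
    DelStep (D.ab :: (w ++ D.a :: z)) (D.ab :: (v ++ D.a :: z)) := by
  obtain ⟨t, i, j, rfl, hm, rfl⟩ := h
  obtain ⟨s, rfl⟩ := hz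
  obtain ⟨hij, hj⟩ := hm.lt
  have hi : i < (t.yield.eraseIdx j).length := by
    rw [List.length_eraseIdx_of_lt hj]; omega
  refine ⟨.node t s, i + 1, j + 1, rfl, .left s hm, ?_⟩
  rw [List.eraseIdx_cons_succ, List.eraseIdx_append_of_lt_length hj,
    List.eraseIdx_cons_succ, List.eraseIdx_append_of_lt_length hi]

theorem DelStep.right {w v z : List D} (h : DelStep w v) (hz : z ∈ LD) :
    DelStep (D.ab :: (z ++ D.a :: w)) (D.ab :: (z ++ D.a :: v)) := by
  obtain ⟨t, i, j, rfl, hm, rfl⟩ := h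
  obtain ⟨s, rfl⟩ := hz
  have key (x : List D) (k : ℕ) :
      (D.ab :: (s.yield ++ D.a :: x)).eraseIdx (s.yield.length + 2 + k) =
        D.ab :: (s.yield ++ D.a :: x.eraseIdx k) := by
    rw [show s.yield.length + 2 + k = s.yield.length + (k + 1) + 1 by omega,
      List.eraseIdx_cons_succ, List.eraseIdx_append_of_length_le (by omega),
      Nat.add_sub_cancel_left, List.eraseIdx_cons_succ]
  refine ⟨.node s t, _, _, rfl, .right s hm, ?_⟩
  rw [key, key]

theorem DelStep.head {w : List D} (hw : w ∈ LD) : DelStep (D.ab :: (w ++ [D.a])) w := by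
  obtain ⟨t, rfl⟩ := hw
  refine ⟨.node t .eps, _, _, rfl, .head t .eps, ?_⟩
  rw [List.eraseIdx_cons_succ, List.eraseIdx_append_of_length_le le_rfl]
  simp

theorem DelStep.ab_a {w : List D} (hw : w ∈ LD) : DelStep (D.ab :: D.a :: w) w := by
  obtain ⟨t, rfl⟩ := hw
  exact ⟨.node .eps t, _, _, rfl, .head .eps t, rfl⟩

theorem dyckLE.left {v w z : List D} (h : dyckLE v w) (hz : z ∈ LD) :
    dyckLE (D.ab :: (v ++ D.a :: z)) (D.ab :: (w ++ D.a :: z)) :=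
  Relation.ReflTransGen.lift (fun x => D.ab :: (x ++ D.a :: z)) (fun _ _ hs => DelStep.left hs hz) _ _ h

theorem dyckLE.right {v w z : List D} (h : dyckLE v w) (hz : z ∈ LD) :
    dyckLE (D.ab :: (z ++ D.a :: v)) (D.ab :: (z ++ D.a :: w)) :=
  Relation.ReflTransGen.lift (fun x => D.ab :: (z ++ D.a :: x)) (fun _ _ hs => DelStep.right hs hz) _ _ h

theorem nil_dyckLE {w : List D} (hw : w ∈ LD) : dyckLE [] w := by
  obtain ⟨t, rfl⟩ := hw
  induction t with
  | eps => exact .refl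
  | node t₁ t₂ ih₁ ih₂ =>
    have h₁ : dyckLE [] [D.ab, D.a] := .single (DelStep.head nil_mem_LD)
    exact h₁.trans ((ih₁.left nil_mem_LD).trans (ih₂.right ⟨t₁, rfl⟩))

theorem dyckLE_wrap {u z : List D} (hu : u ∈ LD) (hz : z ∈ LD) :
    dyckLE u (D.ab :: (u ++ D.a :: z)) :=
  dyckLE.trans (.single (DelStep.head hu)) ((nil_dyckLE hz).right hu)

/-- The word `ā^k u a b₁ … a b_k`, for `bs = [b₁, …, b_k]`. -/
def nest (bs : List (List D)) (u : List D) : List D :=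
  List.replicate bs.length D.ab ++ (u ++ (bs.map (D.a :: ·)).flatten)

theorem nest_cons (b : List D) (bs : List (List D)) (u : List D) :
    nest (b :: bs) u = nest bs (D.ab :: (u ++ D.a :: b)) := by
  simp [nest, List.replicate_succ']

theorem nest_mem_LD {bs : List (List D)} (hbs : ∀ b ∈ bs, b ∈ LD) {u : List D}
    (hu : u ∈ LD) : nest bs u ∈ LD := by
  induction bs generalizing u with
  | nil => simpa [nest] using hu
  | cons b bs ih =>
    rw [List.forall_mem_cons] at hbs
    rw [nest_cons]
    exact ih hbs.2 (cons_append_cons_mem_LD hu hbs.1)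

theorem dyckLE.nest {bs : List (List D)} (hbs : ∀ b ∈ bs, b ∈ LD) {u v : List D}
    (h : dyckLE u v) : dyckLE (nest bs u) (nest bs v) := by
  induction bs generalizing u v with
  | nil => simpa [_root_.nest] using h
  | cons b bs ih =>
    rw [List.forall_mem_cons] at hbs
    rw [nest_cons, nest_cons]
    exact ih hbs.2 (h.left hbs.1)

theorem dyckLE_nest {bs : List (List D)} (hbs : ∀ b ∈ bs, b ∈ LD) {u : List D}
    (hu : u ∈ LD) : dyckLE u (nest bs u) := by
  induction bs generalizing u with
  | nil => simp [nest, dyckLE, Relation.ReflTransGen.refl]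
  | cons b bs ih =>
    rw [List.forall_mem_cons] at hbs
    rw [nest_cons]
    exact (dyckLE_wrap hu hbs.1).trans (ih hbs.2 (cons_append_cons_mem_LD hu hbs.1))

theorem dyckLE_nest_nil_of_mem {bs : List (List D)} (hbs : ∀ b ∈ bs, b ∈ LD) {b : List D}
    (hb : b ∈ bs) : dyckLE (D.ab :: D.a :: b) (nest bs []) := by
  induction bs with
  | nil => simp at hb
  | cons c bs ih =>
    rw [List.forall_mem_cons] at hbs
    have hc := cons_append_cons_mem_LD nil_mem_LD hbs.1
    rw [nest_cons]
    rcases List.mem_cons.1 hb with rfl | hb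
    · exact dyckLE_nest hbs.2 hc
    · exact (ih hbs.2 hb).trans ((nil_dyckLE hc).nest hbs.2)

theorem alphaN_node {L : Type} (l : L) (ts : List (RTree L)) :
    alphaN (.node l ts) =
      D.a :: (List.replicate ts.length D.ab ++ (ts.map alphaN).flatten) := by
  rw [alphaN, List.attach_map_val]

theorem alphaN_eq_cons_tail {L : Type} (t : RTree L) : alphaN t = D.a :: (alphaN t).tail := by
  cases t
  rw [alphaN_node, List.tail_cons]

theorem tail_alphaN_node {L : Type} (l : L) (ts : List (RTree L)) :
    (alphaN (.node l ts)).tail = nest (ts.map fun t => (alphaN t).tail) [] := by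
  simp [alphaN_node, nest, Function.comp_def, ← alphaN_eq_cons_tail]

theorem tail_alphaN_mem_LD {L : Type} : ∀ t : RTree L, (alphaN t).tail ∈ LD
  | .node l ts => by
    rw [tail_alphaN_node]
    refine nest_mem_LD (fun b hb => ?_) nil_mem_LD
    obtain ⟨s, hs, rfl⟩ := List.mem_map.1 hb
    exact tail_alphaN_mem_LD s
decreasing_by
  simp only [RTree.node.sizeOf_spec]
  have := List.sizeOf_lt_of_mem hs
  omega

theorem alphaT_eq {L : Type} (t : RTree L) : alphaT t = D.ab :: D.a :: (alphaN t).tail := by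
  rw [alphaT, ← alphaN_eq_cons_tail]

theorem alphaT_mem_LD {L : Type} (t : RTree L) : alphaT t ∈ LD := by
  rw [alphaT_eq]
  exact cons_append_cons_mem_LD nil_mem_LD (tail_alphaN_mem_LD t)

theorem alphaT_child_dyckLE {L : Type} {c t : RTree L} (hc : c ∈ t.children) :
    dyckLE (alphaT c) (alphaT t) := by
  rw [alphaT_eq t]
  refine dyckLE.trans ?_ (.single (DelStep.ab_a (tail_alphaN_mem_LD t)))
  cases t with
  | node l ts =>
    rw [tail_alphaN_node, alphaT_eq]
    refine dyckLE_nest_nil_of_mem (fun b hb => ?_) (List.mem_map_of_mem hc)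
    obtain ⟨s, -, rfl⟩ := List.mem_map.1 hb
    exact tail_alphaN_mem_LD s

theorem IsSubtree.alphaT_dyckLE {L : Type} {s t : RTree L} (h : IsSubtree s t) :
    dyckLE (alphaT s) (alphaT t) := by
  induction h with
  | refl => exact .refl
  | child t hc _ ih => exact ih.trans (alphaT_child_dyckLE hc)

theorem le_length_harmonicW (q : ℕ) : q ≤ (harmonicW q).length := by
  induction q with
  | zero => exact Nat.zero_le _
  | succ q ih => simp only [harmonicW, List.length_append, List.length_cons]; omega

theorem rank_le_rank {v w : List D} (hv : v ∈ LD) (h : dyckLE v w) : rank v ≤ rank w :=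
  csSup_le_csSup ⟨w.length, fun q hq => (le_length_harmonicW q).trans hq.length_le⟩
    ⟨0, nil_dyckLE hv⟩ fun _ hq => hq.trans h

theorem subtree_footprint_le {N T : Type} (R : Set (N × List (N ⊕ T)))
    (t t₁ : RTree (QLbl N T)) (ht : IsQuasiTree R t) (hsub : IsSubtree t₁ t) :
    dyckLE (alphaT t₁) (alphaT t) ∧ rank (alphaT t₁) ≤ rank (alphaT t) :=
  ⟨hsub.alphaT_dyckLE, rank_le_rank (alphaT_mem_LD t₁) hsub.alphaT_dyckLE⟩
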